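/- Let G be a directed polymatroidal network and let x ∈ ℝ≥0^{V∪E} with ∑_{v∈V} deg_v x_v > 0. Then there exist a set S ⊆ {v ∈ V : x_v > 0} with vol(S) > 0 and a valid assignment g : δ⁺(S) ∪ δ⁻(S) → V such that (cut(δ⁺(S), g restricted to δ⁺(S)) + cut(δ⁻(S), g restricted to δ⁻(S))) / vol(S) ≤ 2 · [∑_{v∈V}(ρ̂⁺_v(c⁺(x,v)) + ρ̂⁻_v(c⁻(x,v)))] / ∑_{v∈V} deg_v x_v, where c⁺(x,v) = (|x_v − x_e|)_{e∈δ⁺(v)} and c⁻(x,v) = (|x_v − x_e|)_{e∈δ⁻(v)}. -/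

import Mathlib

open MeasureTheory

/-- Lovász extension of the set function `f`, with ground set `D`,
evaluated at the (nonnegative) vector `x`. -/
noncomputable def lovOn {E : Type*} (f : Set E → ℝ) (D : Set E) (x : E → ℝ) : ℝ :=
  ∫ θ in Set.Ioi (0 : ℝ), f (D ∩ {e | θ ≤ x e})

/-- A directed polymatroidal network on vertex type `V` and edge type `E`. -/
structure PolyNet (V E : Type*) [Fintype V] [Fintype E] where
  tail : E → V
  head : E → V
  w : V → ℝ
  w_nonneg : ∀ v, 0 ≤ w v
  ρp : V → Set E → ℝ
  ρm : V → Set E → ℝ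
  ρp_nonneg : ∀ v A, 0 ≤ ρp v A
  ρm_nonneg : ∀ v A, 0 ≤ ρm v A
  ρp_empty : ∀ v, ρp v ∅ = 0
  ρm_empty : ∀ v, ρm v ∅ = 0
  ρp_mono : ∀ v A B, A ⊆ B → B ⊆ {e | tail e = v} → ρp v A ≤ ρp v B
  ρm_mono : ∀ v A B, A ⊆ B → B ⊆ {e | head e = v} → ρm v A ≤ ρm v B
  ρp_submod : ∀ v A B, A ⊆ {e | tail e = v} → B ⊆ {e | tail e = v} →
    ρp v (A ∪ B) + ρp v (A ∩ B) ≤ ρp v A + ρp v B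
  ρm_submod : ∀ v A B, A ⊆ {e | head e = v} → B ⊆ {e | head e = v} →
    ρm v (A ∪ B) + ρm v (A ∩ B) ≤ ρm v A + ρm v B

namespace PolyNet

variable {V E : Type*} [Fintype V] [Fintype E] (N : PolyNet V E)

/-- The set of edges leaving `v`. -/
def outE (v : V) : Set E := {e | N.tail e = v}

/-- The set of edges entering `v`. -/
def inE (v : V) : Set E := {e | N.head e = v}

/-- The degree of a vertex. -/
noncomputable def deg (v : V) : ℝ := N.ρp v (N.outE v) + N.ρm v (N.inE v)

/-- The volume of a set of vertices. -/
noncomputable def vol (S : Set V) : ℝ := ∑ v, S.indicator N.deg v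

/-- The total weight of a set of vertices. -/
noncomputable def wsum (S : Set V) : ℝ := ∑ v, S.indicator N.w v

/-- An assignment `g` of (cut) edges to vertices is valid on `F` if every edge of `F` is
assigned to one of its endpoints. -/
def valid (F : Set E) (g : E → V) : Prop := ∀ e ∈ F, g e = N.tail e ∨ g e = N.head e

/-- The cost of the cut `F` under the assignment `g`. -/
noncomputable def cutCost (F : Set E) (g : E → V) : ℝ :=
  ∑ v, (N.ρp v (N.outE v ∩ F ∩ {e | g e = v}) + N.ρm v (N.inE v ∩ F ∩ {e | g e = v}))

/-- The cost of the cut `F`: minimum over valid assignments. -/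
noncomputable def cut (F : Set E) : ℝ :=
  sInf {c | ∃ g : E → V, N.valid F g ∧ c = N.cutCost F g}

/-- Edges from `S` to its complement. -/
def dplus (S : Set V) : Set E := {e | N.tail e ∈ S ∧ N.head e ∉ S}

/-- Edges from the complement of `S` into `S`. -/
def dminus (S : Set V) : Set E := {e | N.tail e ∉ S ∧ N.head e ∈ S}

/-- The (directed) value of the cut induced by `S`. -/
noncomputable def cutval (S : Set V) : ℝ := min (N.cut (N.dplus S)) (N.cut (N.dminus S))

/-- The symmetric value of the cut induced by `S`. -/
noncomputable def symcutval (S : Set V) : ℝ := N.cut (N.dplus S) + N.cut (N.dminus S)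

/-- The Rayleigh quotient `R⁺`. -/
noncomputable def Rp (x : V ⊕ E → ℝ) : ℝ :=
  (∑ v, (lovOn (N.ρp v) (N.outE v) (fun e => (max 0 (x (Sum.inl v) - x (Sum.inr e)))^2)
       + lovOn (N.ρm v) (N.inE v) (fun e => (max 0 (x (Sum.inr e) - x (Sum.inl v)))^2)))
  / ∑ v, N.deg v * (x (Sum.inl v))^2

/-- The Rayleigh quotient `R⁻`. -/
noncomputable def Rm (x : V ⊕ E → ℝ) : ℝ :=
  (∑ v, (lovOn (N.ρp v) (N.outE v) (fun e => (max 0 (x (Sum.inr e) - x (Sum.inl v)))^2)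
       + lovOn (N.ρm v) (N.inE v) (fun e => (max 0 (x (Sum.inl v) - x (Sum.inr e)))^2)))
  / ∑ v, N.deg v * (x (Sum.inl v))^2

/-- The Rayleigh quotient `R`. -/
noncomputable def Ray (x : V ⊕ E → ℝ) : ℝ := min (N.Rp x) (N.Rm x)

/-- The symmetric Rayleigh quotient `R̄`. -/
noncomputable def RaySym (x : V ⊕ E → ℝ) : ℝ := N.Rp x + N.Rm x

/-- The spectral gap `γ₂` of a polymatroidal network. -/
noncomputable def gap : ℝ :=
  sInf {r | ∃ x : V ⊕ E → ℝ, (∑ v, N.deg v * x (Sum.inl v)) = 0 ∧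
    (0 < ∑ v, N.deg v * (x (Sum.inl v))^2) ∧ r = N.Ray x}

end PolyNet

/-- A set function on a finite type, composed with a measurable family of sets, is measurable. -/
theorem measurable_setFunction_comp {E : Type*} [Finite E] (f : Set E → ℝ) {P : ℝ → Set E}
    (hP : ∀ e, MeasurableSet {t | e ∈ P t}) : Measurable fun t => f (P t) := by
  have hf : Measurable fun p : E → Prop => f {e | p e} := measurable_of_countable _
  exact hf.comp (measurable_pi_lambda (fun t e => e ∈ P t) fun e => measurableSet_setOfPred.mp (hP e))

/-- A normalized set function on a finite type, composed with a measurable family of sets that is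
empty outside a bounded interval, is integrable. -/
theorem integrable_setFunction_comp {E : Type*} [Finite E] (f : Set E → ℝ) (hf : f ∅ = 0)
    {P : ℝ → Set E} (hP : ∀ e, MeasurableSet {t | e ∈ P t}) {a b : ℝ}
    (hempty : ∀ t, t ∉ Set.Icc a b → P t = ∅) : Integrable fun t => f (P t) := by
  obtain ⟨C, hC⟩ := (Set.finite_range fun A : Set E => ‖f A‖).bddAbove
  have hon : IntegrableOn (fun t => f (P t)) (Set.Icc a b) :=
    Measure.integrableOn_of_bounded measure_Icc_lt_top.ne
      (measurable_setFunction_comp f hP).aestronglyMeasurable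
      (M := C) (Filter.Eventually.of_forall fun t => hC ⟨P t, rfl⟩)
  refine hon.integrable_of_forall_notMem_eq_zero fun t ht => ?_
  rw [hempty t ht, hf]

/-- The elements of `D` whose value is separated from `a` by the threshold `t`. -/
def separatedOn {E : Type*} (D : Set E) (a : ℝ) (y : E → ℝ) (t : ℝ) : Set E :=
  {e | e ∈ D ∧ (y e ≤ t ∧ t < a ∨ a ≤ t ∧ t < y e)}

theorem integrable_separatedOn {E : Type*} [Finite E] (f : Set E → ℝ) (hf : f ∅ = 0) (D : Set E)
    (a : ℝ) (y : E → ℝ) : Integrable fun t => f (separatedOn D a y t) := by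
  obtain ⟨C, hC⟩ := (Set.finite_range fun e => |a - y e|).bddAbove
  refine integrable_setFunction_comp f hf (a := a - C) (b := a + C) (fun e => ?_) fun t ht => ?_
  · simp only [separatedOn, Set.mem_ofPred_eq]
    measurability
  · refine Set.eq_empty_of_forall_notMem fun e he => ht ?_
    have h := abs_le.mp (hC ⟨e, rfl⟩ : |a - y e| ≤ C)
    rcases he.2 with he | he <;> constructor <;> linarith

/-- Integrating a monotone set function over the elements separated from `a` costs at most twice
the Lovász extension of the distances to `a`. -/
theorem integral_separatedOn_le {E : Type*} [Finite E] (f : Set E → ℝ) (hf : f ∅ = 0)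
    (hnonneg : ∀ A, 0 ≤ f A) (D : Set E) (hmono : ∀ A B, A ⊆ B → B ⊆ D → f A ≤ f B)
    (a : ℝ) (y : E → ℝ) :
    ∫ t in Set.Ioi (0 : ℝ), f (separatedOn D a y t) ≤ 2 * lovOn f D fun e => |a - y e| := by
  let P : ℝ → Set E := fun θ => {e | 0 ≤ θ ∧ e ∈ D ∧ θ ≤ |a - y e|}
  have hP : Integrable fun θ => f (P θ) := by
    obtain ⟨C, hC⟩ := (Set.finite_range fun e => |a - y e|).bddAbove
    refine integrable_setFunction_comp f hf (a := 0) (b := C) (fun e => ?_) fun t ht => ?_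
    · simp only [P, Set.mem_ofPred_eq]
      measurability
    · exact Set.eq_empty_of_forall_notMem fun e he => ht ⟨he.1, he.2.2.trans (hC ⟨e, rfl⟩)⟩
  have hlov : ∫ θ, f (P θ) = lovOn f D fun e => |a - y e| := by
    rw [lovOn, ← integral_Ici_eq_integral_Ioi, ← integral_indicator measurableSet_Ici]
    refine integral_congr_ae (Filter.Eventually.of_forall fun θ => ?_)
    by_cases hθ : 0 ≤ θ
    · simp [P, hθ, Set.inter_def]
    · simp [P, hθ, hf]
  calc ∫ t in Set.Ioi (0 : ℝ), f (separatedOn D a y t)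
      ≤ ∫ t, f (separatedOn D a y t) :=
        setIntegral_le_integral (integrable_separatedOn f hf D a y)
          (Filter.Eventually.of_forall fun _ => hnonneg _)
    _ ≤ ∫ t, (f (P (a - t)) + f (P (t - a))) := by
        refine integral_mono (integrable_separatedOn f hf D a y)
          ((hP.comp_sub_left a).add (hP.comp_sub_right a)) fun t => ?_
        rcases lt_or_ge t a with h | h
        · refine (hmono _ (P (a - t)) (fun e he => ⟨by linarith, he.1, ?_⟩)
            fun e he => he.2.1).trans (le_add_of_nonneg_right (hnonneg _))
          rcases he.2 with he | he
          · exact le_trans (by linarith) (le_abs_self _)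
          · linarith
        · refine (hmono _ (P (t - a)) (fun e he => ⟨by linarith, he.1, ?_⟩)
            fun e he => he.2.1).trans (le_add_of_nonneg_left (hnonneg _))
          rcases he.2 with he | he
          · linarith
          · exact le_trans (by linarith) (neg_le_abs _)
    _ = 2 * lovOn f D fun e => |a - y e| := by
        rw [integral_add (hP.comp_sub_left a) (hP.comp_sub_right a),
          integral_sub_left_eq_self (fun θ => f (P θ)), integral_sub_right_eq_self fun θ => f (P θ),
          hlov, two_mul]

namespace PolyNet

variable {V E : Type*} [Fintype V] [Fintype E] (N : PolyNet V E)

theorem deg_nonneg (v : V) : 0 ≤ N.deg v :=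
  add_nonneg (N.ρp_nonneg _ _) (N.ρm_nonneg _ _)

theorem vol_nonneg (S : Set V) : 0 ≤ N.vol S :=
  Finset.sum_nonneg fun v _ => Set.indicator_nonneg (fun v _ => N.deg_nonneg v) v

/-- The vertices whose value exceeds the threshold `t`. -/
def superlevel (x : V ⊕ E → ℝ) (t : ℝ) : Set V := {v | t < x (Sum.inl v)}

open Classical in
/-- Each edge is assigned to its tail if `t` separates the edge from its tail, and to its head
otherwise. -/
noncomputable def thresholdAssignment (x : V ⊕ E → ℝ) (t : ℝ) (e : E) : V :=
  if e ∈ separatedOn Set.univ (x (Sum.inl (N.tail e))) (fun e => x (Sum.inr e)) t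
  then N.tail e else N.head e

/-- The total capacity, over all vertices, of the incident edges separated from the vertex by the
threshold `t`. -/
noncomputable def separatedCost (x : V ⊕ E → ℝ) (t : ℝ) : ℝ :=
  ∑ v, (N.ρp v (separatedOn (N.outE v) (x (Sum.inl v)) (fun e => x (Sum.inr e)) t)
      + N.ρm v (separatedOn (N.inE v) (x (Sum.inl v)) (fun e => x (Sum.inr e)) t))

theorem separatedCost_nonneg (x : V ⊕ E → ℝ) (t : ℝ) : 0 ≤ N.separatedCost x t :=
  Finset.sum_nonneg fun _ _ => add_nonneg (N.ρp_nonneg _ _) (N.ρm_nonneg _ _)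

theorem valid_thresholdAssignment (x : V ⊕ E → ℝ) (t : ℝ) (F : Set E) :
    N.valid F (N.thresholdAssignment x t) := by
  intro e _
  unfold thresholdAssignment
  split_ifs <;> simp

/-- A cut edge is assigned by the threshold assignment to an endpoint that `t` separates it from. -/
theorem separated_of_thresholdAssignment_eq (x : V ⊕ E → ℝ) (t : ℝ) {e : E} {v : V}
    (he : e ∈ N.dplus (superlevel x t) ∪ N.dminus (superlevel x t))
    (hg : N.thresholdAssignment x t e = v) :
    x (Sum.inr e) ≤ t ∧ t < x (Sum.inl v) ∨ x (Sum.inl v) ≤ t ∧ t < x (Sum.inr e) := by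
  simp only [dplus, dminus, superlevel, Set.mem_union, Set.mem_ofPred_eq, not_lt] at he
  unfold thresholdAssignment at hg
  simp only [separatedOn, Set.mem_univ, true_and, Set.mem_ofPred_eq] at hg
  split_ifs at hg with h
  · exact hg ▸ h
  · subst hg
    rcases lt_or_ge t (x (Sum.inr e)) with h' | h' <;> grind

theorem cutCost_thresholdAssignment_le (x : V ⊕ E → ℝ) (t : ℝ) :
    N.cutCost (N.dplus (superlevel x t)) (N.thresholdAssignment x t)
      + N.cutCost (N.dminus (superlevel x t)) (N.thresholdAssignment x t)
      ≤ N.separatedCost x t := by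
  have hsub : ∀ v (D F : Set E), F ⊆ N.dplus (superlevel x t) ∪ N.dminus (superlevel x t) →
      D ∩ F ∩ {e | N.thresholdAssignment x t e = v}
        ⊆ separatedOn D (x (Sum.inl v)) (fun e => x (Sum.inr e)) t := fun v D F hF e he =>
    ⟨he.1.1, N.separated_of_thresholdAssignment_eq x t (hF he.1.2) he.2⟩
  have hp := fun v F hF => N.ρp_mono v _ _ (hsub v (N.outE v) F hF) fun e he => he.1
  have hm := fun v F hF => N.ρm_mono v _ _ (hsub v (N.inE v) F hF) fun e he => he.1
  rw [cutCost, cutCost, separatedCost, ← Finset.sum_add_distrib]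
  refine Finset.sum_le_sum fun v _ => ?_
  have hp₁ := hp v _ Set.subset_union_left
  have hp₂ := hp v _ Set.subset_union_right
  have hm₁ := hm v _ Set.subset_union_left
  have hm₂ := hm v _ Set.subset_union_right
  by_cases hv : v ∈ superlevel x t
  · have hout : N.outE v ∩ N.dminus (superlevel x t) = ∅ := by
      ext e; simp only [outE, dminus]; grind
    have hin : N.inE v ∩ N.dplus (superlevel x t) = ∅ := by
      ext e; simp only [inE, dplus]; grind
    simp only [hout, hin, Set.empty_inter, N.ρp_empty, N.ρm_empty]
    linarith
  · have hout : N.outE v ∩ N.dplus (superlevel x t) = ∅ := by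
      ext e; simp only [outE, dplus]; grind
    have hin : N.inE v ∩ N.dminus (superlevel x t) = ∅ := by
      ext e; simp only [inE, dminus]; grind
    simp only [hout, hin, Set.empty_inter, N.ρp_empty, N.ρm_empty]
    linarith

theorem integrable_separatedCost (x : V ⊕ E → ℝ) : Integrable (N.separatedCost x) :=
  integrable_finsetSum _ fun v _ =>
    (integrable_separatedOn _ (N.ρp_empty v) _ _ _).add
      (integrable_separatedOn _ (N.ρm_empty v) _ _ _)

theorem integral_separatedCost_le (x : V ⊕ E → ℝ) :
    ∫ t in Set.Ioi (0 : ℝ), N.separatedCost x t ≤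
      2 * ∑ v, (lovOn (N.ρp v) (N.outE v) (fun e => |x (Sum.inl v) - x (Sum.inr e)|)
              + lovOn (N.ρm v) (N.inE v) (fun e => |x (Sum.inl v) - x (Sum.inr e)|)) := by
  have hp := fun v => (integrable_separatedOn _ (N.ρp_empty v) (N.outE v) (x (Sum.inl v))
    fun e => x (Sum.inr e)).integrableOn (s := Set.Ioi 0)
  have hm := fun v => (integrable_separatedOn _ (N.ρm_empty v) (N.inE v) (x (Sum.inl v))
    fun e => x (Sum.inr e)).integrableOn (s := Set.Ioi 0)
  unfold separatedCost
  rw [integral_finsetSum, Finset.mul_sum]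
  swap
  · exact fun v _ => (hp v).add (hm v)
  refine Finset.sum_le_sum fun v _ => ?_
  rw [integral_add (hp v) (hm v), mul_add]
  exact add_le_add
    (integral_separatedOn_le _ (N.ρp_empty v) (N.ρp_nonneg v) _ (N.ρp_mono v) _ _)
    (integral_separatedOn_le _ (N.ρm_empty v) (N.ρm_nonneg v) _ (N.ρm_mono v) _ _)

theorem vol_superlevel (x : V ⊕ E → ℝ) (t : ℝ) :
    N.vol (superlevel x t) =
      ∑ v, (Set.Iio (x (Sum.inl v))).indicator (fun _ => N.deg v) t := by
  simp [vol, superlevel, Set.indicator_apply]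

theorem integrableOn_indicator_Iio (a c : ℝ) :
    IntegrableOn ((Set.Iio a).indicator fun _ => c) (Set.Ioi 0) := by
  rw [IntegrableOn, integrable_indicator_iff measurableSet_Iio, IntegrableOn,
    Measure.restrict_restrict measurableSet_Iio, Set.Iio_inter_Ioi]
  exact integrableOn_const measure_Ioo_lt_top.ne

theorem integrableOn_vol_superlevel (x : V ⊕ E → ℝ) :
    IntegrableOn (fun t => N.vol (superlevel x t)) (Set.Ioi 0) := by
  simp only [vol_superlevel]
  exact integrable_finsetSum _ fun v _ => integrableOn_indicator_Iio _ _

theorem integral_vol_superlevel (x : V ⊕ E → ℝ) (hx : ∀ v, 0 ≤ x (Sum.inl v)) :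
    ∫ t in Set.Ioi (0 : ℝ), N.vol (superlevel x t) = ∑ v, N.deg v * x (Sum.inl v) := by
  simp only [vol_superlevel]
  rw [integral_finsetSum _ fun v _ => integrableOn_indicator_Iio _ _]
  refine Finset.sum_congr rfl fun v _ => ?_
  rw [setIntegral_indicator measurableSet_Iio, Set.Ioi_inter_Iio, setIntegral_const,
    Real.volume_real_Ioo_of_le (hx v), sub_zero, smul_eq_mul, mul_comm]

end PolyNet

/-- If `∫ u ≤ K` and `∫ v = D > 0` with `u` and `v` nonnegative, then some point of positive `v`
has `u / v ≤ K / D`; it can be found in any set of full measure. -/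
theorem exists_pos_mul_le_of_integral_le {μ : Measure ℝ} {u v : ℝ → ℝ} {K D : ℝ}
    (hu : Integrable u μ) (hv : Integrable v μ) (hu₀ : ∀ t, 0 ≤ u t) (hv₀ : ∀ t, 0 ≤ v t)
    (huK : ∫ t, u t ∂μ ≤ K) (hvD : ∫ t, v t ∂μ = D) (hD : 0 < D) (s : Set ℝ)
    (hs : ∀ᵐ t ∂μ, t ∈ s) : ∃ t ∈ s, 0 < v t ∧ D * u t ≤ K * v t := by
  by_contra! h
  have hint : Integrable (fun t => D * u t - K * v t) μ := (hu.const_mul D).sub (hv.const_mul K)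
  have hnonneg : 0 ≤ᵐ[μ] fun t => D * u t - K * v t := by
    filter_upwards [hs] with t ht
    rcases (hv₀ t).eq_or_lt with h0 | h0
    · simpa [← h0] using mul_nonneg hD.le (hu₀ t)
    · exact sub_nonneg.mpr (h t ht h0).le
  have hle : ∫ t, (D * u t - K * v t) ∂μ ≤ 0 := by
    rw [integral_sub (hu.const_mul D) (hv.const_mul K), integral_const_mul, integral_const_mul, hvD]
    nlinarith
  have hzero := (integral_eq_zero_iff_of_nonneg_ae hnonneg hint).mp
    (hle.antisymm (integral_nonneg_of_ae hnonneg))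
  have hv_zero : v =ᵐ[μ] 0 := by
    filter_upwards [hs, hzero] with t ht hzt
    by_contra hne
    have := h t ht ((hv₀ t).lt_of_ne' hne)
    simp only [Pi.zero_apply] at hzt
    linarith
  rw [integral_congr_ae hv_zero] at hvD
  simp at hvD
  linarith

/-- Undirected version of the line-embedding lemma: for nonnegative `x` with
`∑_v deg_v x_v > 0` there is a set `S` supported on `{v : x_v > 0}` and a valid
assignment `g` of `δ⁺(S) ∪ δ⁻(S)` with
`(cut(δ⁺(S),g) + cut(δ⁻(S),g)) / vol S` bounded by twice the Lovász-extension
quotient with absolute differences. -/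
theorem line_embedding_undirected {V E : Type*} [Fintype V] [Fintype E] (N : PolyNet V E)
    (x : V ⊕ E → ℝ) (hx : ∀ i, 0 ≤ x i)
    (hpos : 0 < ∑ v, N.deg v * x (Sum.inl v)) :
    ∃ (S : Set V) (g : E → V),
      S ⊆ {v | 0 < x (Sum.inl v)} ∧ 0 < N.vol S ∧
      N.valid (N.dplus S ∪ N.dminus S) g ∧
      (N.cutCost (N.dplus S) g + N.cutCost (N.dminus S) g) / N.vol S ≤
        2 * (∑ v, (lovOn (N.ρp v) (N.outE v) (fun e => |x (Sum.inl v) - x (Sum.inr e)|)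
                 + lovOn (N.ρm v) (N.inE v) (fun e => |x (Sum.inl v) - x (Sum.inr e)|)))
          / ∑ v, N.deg v * x (Sum.inl v) := by
  obtain ⟨t, ht, hvol, hle⟩ := exists_pos_mul_le_of_integral_le
    (N.integrable_separatedCost x).integrableOn (N.integrableOn_vol_superlevel x)
    (N.separatedCost_nonneg x) (fun t => N.vol_nonneg _) (N.integral_separatedCost_le x)
    (N.integral_vol_superlevel x fun v => hx _) hpos (Set.Ioi 0)
    (ae_restrict_mem measurableSet_Ioi)
  refine ⟨PolyNet.superlevel x t, N.thresholdAssignment x t, ?_, hvol,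
    N.valid_thresholdAssignment x t _, ?_⟩
  · exact fun v (hv : t < x (Sum.inl v)) => lt_trans (Set.mem_Ioi.mp ht) hv
  rw [div_le_div_iff₀ hvol hpos]
  refine le_trans ?_ hle
  rw [mul_comm]
  exact mul_le_mul_of_nonneg_left (N.cutCost_thresholdAssignment_le x t) hpos.le
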